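/- Let 𝕋 be a time scale and α ∈ (0,1]. Let f : 𝕋 → ℝ be strictly increasing with 𝕋̃ := f(𝕋) a time scale (a nonempty closed subset of ℝ), and suppose f is nabla fractional differentiable of order 1 at every point of 𝕋^k with ∇^(1)f continuous on 𝕋^k. Let f⁻¹ : 𝕋̃ → 𝕋 denote the inverse of f. Then for every t ∈ 𝕋̃^k with (∇^(1)f)(f⁻¹(t)) ≠ 0, f⁻¹ is nabla fractional differentiable of order α at t with ∇^(α)f⁻¹(t) = (ν̃(t))^{1−α} / (∇^(1)f)(f⁻¹(t)) if α ≠ 1, and ∇^(α)f⁻¹(t) = 1 / (∇^(1)f)(f⁻¹(t)) if α = 1, where ν̃ is the graininess function of the time scale 𝕋̃. -/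

import Mathlib

open Set Filter
open scoped Classical

/-- Backward jump operator on a time scale `T`. -/
noncomputable def rho (T : Set ℝ) (t : ℝ) : ℝ :=
  if ({s ∈ T | s < t}).Nonempty then sSup {s ∈ T | s < t} else t

/-- Forward jump operator on a time scale `T`. -/
noncomputable def sigmaTS (T : Set ℝ) (t : ℝ) : ℝ :=
  if ({s ∈ T | t < s}).Nonempty then sInf {s ∈ T | t < s} else t

/-- Graininess `ν(t) = t - ρ(t)`. -/
noncomputable def nu (T : Set ℝ) (t : ℝ) : ℝ := t - rho T t

/-- `𝕋^k`: remove the minimum of `T` when it exists and is right-scattered. -/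
def Tk (T : Set ℝ) : Set ℝ :=
  {t ∈ T | ¬ (IsLeast T t ∧ t < sigmaTS T t)}

/-- The set `Q = {1/q : q an odd positive integer}`. -/
def QOdd : Set ℝ := {x : ℝ | ∃ q : ℕ, Odd q ∧ 0 < q ∧ x = 1 / (q : ℝ)}

/-- Real odd root power: `sign(x) * |x| ^ α`. -/
noncomputable def oddPow (α x : ℝ) : ℝ := Real.sign x * |x| ^ α

/-- The power `x ^ α` used in nabla fractional differentiation: the real odd
root when `α ∈ QOdd`, the usual real power otherwise. -/
noncomputable def fpow (α x : ℝ) : ℝ := if α ∈ QOdd then oddPow α x else x ^ α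

/-- The neighborhood of `t` used in the definition of the nabla fractional
derivative: `U_δ(t)` when `α ∈ QOdd`, `U_δ⁻(t)` otherwise. -/
noncomputable def Unbhd (T : Set ℝ) (α t δ : ℝ) : Set ℝ :=
  if α ∈ QOdd then Ioo (t - δ) (t + δ) ∩ T else Ioo (t - δ) t ∩ T

/-- `f` is nabla fractional differentiable of order `α` at `t ∈ T^k` with
derivative `L`. -/
def nablaDiffAt (T : Set ℝ) (α : ℝ) (f : ℝ → ℝ) (t L : ℝ) : Prop :=
  ∀ ε > 0, ∃ δ > 0, ∀ s ∈ Unbhd T α t δ,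
    |(f (rho T t) - f s) - L * fpow α (rho T t - s)| ≤ ε * |rho T t - s| ^ α

/-- `f` is continuous at `t` in the time-scale sense. -/
def contAt (T : Set ℝ) (f : ℝ → ℝ) (t : ℝ) : Prop :=
  ∀ ε > 0, ∃ δ > 0, ∀ s ∈ Ioo (t - δ) (t + δ) ∩ T, |f t - f s| < ε

/-- `f` is left-continuous at `t` in the time-scale sense. -/
def leftContAt (T : Set ℝ) (f : ℝ → ℝ) (t : ℝ) : Prop :=
  ∀ ε > 0, ∃ δ > 0, ∀ s ∈ Ioo (t - δ) t ∩ T, |f t - f s| < ε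

/-- `f` has a local left-maximum at `t₀`. -/
def localLeftMax (T : Set ℝ) (f : ℝ → ℝ) (t₀ : ℝ) : Prop :=
  (rho T t₀ < t₀ → f (rho T t₀) ≤ f t₀) ∧
  (rho T t₀ = t₀ → ∃ δ > 0, ∀ s ∈ Ioo (t₀ - δ) t₀ ∩ T, f s ≤ f t₀)

/-- `f` has a local left-minimum at `t₀`. -/
def localLeftMin (T : Set ℝ) (f : ℝ → ℝ) (t₀ : ℝ) : Prop :=
  (rho T t₀ < t₀ → f t₀ ≤ f (rho T t₀)) ∧
  (rho T t₀ = t₀ → ∃ δ > 0, ∀ s ∈ Ioo (t₀ - δ) t₀ ∩ T, f t₀ ≤ f s)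

theorem one_mem_QOdd : (1 : ℝ) ∈ QOdd := ⟨1, odd_one, one_pos, by norm_num⟩

theorem oddPow_one (x : ℝ) : oddPow 1 x = x := by
  rw [oddPow, Real.rpow_one]
  rcases lt_trichotomy x 0 with h | h | h
  · rw [Real.sign_of_neg h, abs_of_neg h]; ring
  · simp [h]
  · rw [Real.sign_of_pos h, abs_of_pos h]; ring

theorem rho_le (T : Set ℝ) (t : ℝ) : rho T t ≤ t := by
  unfold rho
  split_ifs with h
  · exact csSup_le h fun s hs => hs.2.le
  · exact le_rfl

theorem le_rho {T : Set ℝ} {s t : ℝ} (hs : s ∈ T) (hst : s < t) : s ≤ rho T t := by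
  have h : ({s ∈ T | s < t}).Nonempty := ⟨s, hs, hst⟩
  rw [rho, if_pos h]
  exact le_csSup ⟨t, fun x hx => hx.2.le⟩ ⟨hs, hst⟩

theorem rho_mem {T : Set ℝ} (hT : IsClosed T) {t : ℝ} (ht : t ∈ T) : rho T t ∈ T := by
  unfold rho
  split_ifs with h
  · exact closure_minimal (fun x hx => hx.1) hT
      (csSup_mem_closure h ⟨t, fun x hx => hx.2.le⟩)
  · exact ht

theorem mem_Unbhd_one {T : Set ℝ} {t δ s : ℝ} :
    s ∈ Unbhd T 1 t δ ↔ s ∈ Ioo (t - δ) (t + δ) ∩ T := by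
  rw [Unbhd, if_pos one_mem_QOdd]

theorem fpow_one (x : ℝ) : fpow 1 x = x := by
  rw [fpow, if_pos one_mem_QOdd, oddPow_one]

theorem nablaDiffAt_one_iff {T : Set ℝ} {f : ℝ → ℝ} {t L : ℝ} :
    nablaDiffAt T 1 f t L ↔ ∀ ε > 0, ∃ δ > 0, ∀ s ∈ Ioo (t - δ) (t + δ) ∩ T,
      |(f (rho T t) - f s) - L * (rho T t - s)| ≤ ε * |rho T t - s| := by
  simp only [nablaDiffAt, mem_Unbhd_one, fpow_one, Real.rpow_one]

theorem Unbhd_subset {T : Set ℝ} {α t δ : ℝ} (hδ : 0 < δ) :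
    Unbhd T α t δ ⊆ Ioo (t - δ) (t + δ) ∩ T := by
  unfold Unbhd
  split_ifs
  · exact subset_rfl
  · exact inter_subset_inter_left _ (Ioo_subset_Ioo_right (by linarith))

/-- On the relevant neighborhood, the two conventions for the power agree. -/
theorem fpow_eq_oddPow {T : Set ℝ} {α t δ s : ℝ} (hα : 0 < α) (hs : s ∈ Unbhd T α t δ) :
    fpow α (rho T t - s) = oddPow α (rho T t - s) := by
  unfold fpow
  split_ifs with h
  · rfl
  · rw [Unbhd, if_neg h] at hs
    have h0 : 0 ≤ rho T t - s := sub_nonneg.2 (le_rho hs.2 hs.1.2)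
    rcases h0.eq_or_lt with h1 | h1
    · simp [oddPow, ← h1, hα.ne']
    · rw [oddPow, Real.sign_of_pos h1, abs_of_pos h1, one_mul]

/-- Differentiability of order `1` implies differentiability of every order `α ∈ (0, 1]`. -/
theorem nablaDiffAt_of_one {T : Set ℝ} {α : ℝ} (hα : α ∈ Ioc (0 : ℝ) 1) {g : ℝ → ℝ} {t L : ℝ}
    (h : nablaDiffAt T 1 g t L) : nablaDiffAt T α g t (nu T t ^ (1 - α) * L) := by
  rw [nablaDiffAt_one_iff] at h
  intro ε hε
  have hν : 0 ≤ nu T t := sub_nonneg.2 (rho_le T t)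
  have hc : 0 ≤ nu T t ^ (1 - α) := Real.rpow_nonneg hν _
  set c := nu T t ^ (1 - α) with hc_def
  have hcont : Continuous fun s : ℝ => |rho T t - s| ^ (1 - α) :=
    (continuous_const.sub continuous_id).abs.rpow_const
      fun _ => Or.inr (sub_nonneg.2 hα.2)
  have hct : |rho T t - t| ^ (1 - α) = c := by
    rw [abs_sub_comm, hc_def, ← abs_of_nonneg hν]; rfl
  obtain ⟨δ₁, hδ₁, h₁⟩ := h (ε / (2 * (c + 1))) (by positivity)
  obtain ⟨δ₂, hδ₂, h₂⟩ := Metric.continuous_iff.1 hcont t (min 1 (ε / (2 * (|L| + 1))))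
    (by positivity)
  refine ⟨min δ₁ δ₂, lt_min hδ₁ hδ₂, fun s hs => ?_⟩
  rw [fpow_eq_oddPow hα.1 hs]
  obtain ⟨⟨hs₁, hs₂⟩, hsT⟩ := Unbhd_subset (lt_min hδ₁ hδ₂) hs
  have hm₁ := min_le_left δ₁ δ₂
  have hm₂ := min_le_right δ₁ δ₂
  have hs_one := h₁ s ⟨⟨by linarith, by linarith⟩, hsT⟩
  have hs_near := h₂ s (by rw [Real.dist_eq, abs_lt]; constructor <;> linarith)
  rw [Real.dist_eq, hct, lt_min_iff] at hs_near
  set d := rho T t - s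
  have hp : 0 ≤ |d| ^ α := Real.rpow_nonneg (abs_nonneg d) _
  have hφ : |d| = |d| ^ α * |d| ^ (1 - α) := by
    rw [← Real.rpow_add_of_nonneg (abs_nonneg d) hα.1.le (sub_nonneg.2 hα.2)]
    simp
  have hd : d = Real.sign d * |d| := by
    simpa [oddPow] using (oddPow_one d).symm
  set φ := |d| ^ (1 - α)
  have hsign : |Real.sign d| ≤ 1 := by
    rcases Real.sign_apply_eq d with h | h | h <;> simp [h]
  have hcorr : |L * d - c * L * oddPow α d| ≤ |L| * |φ - c| * |d| ^ α := by
    have heq : L * d - c * L * oddPow α d = Real.sign d * (L * (φ - c) * |d| ^ α) := by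
      have hd' : d = Real.sign d * (|d| ^ α * φ) := by rw [← hφ]; exact hd
      rw [oddPow]
      linear_combination L * hd'
    rw [heq, abs_mul, abs_mul, abs_mul, abs_of_nonneg hp]
    exact mul_le_of_le_one_left (by positivity) hsign
  have hφc : φ ≤ c + 1 := by linarith [(abs_lt.1 hs_near.1).2]
  have hhalf₁ : ε / (2 * (c + 1)) * φ ≤ ε / 2 := by
    calc ε / (2 * (c + 1)) * φ ≤ ε / (2 * (c + 1)) * (c + 1) := by gcongr
      _ = ε / 2 := by field_simp
  have hhalf₂ : |L| * |φ - c| ≤ ε / 2 := by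
    calc |L| * |φ - c| ≤ (|L| + 1) * (ε / (2 * (|L| + 1))) := by
          gcongr
          · linarith
          · exact hs_near.2.le
      _ = ε / 2 := by field_simp
  calc |g (rho T t) - g s - c * L * oddPow α d|
      ≤ |g (rho T t) - g s - L * d| + |L * d - c * L * oddPow α d| := abs_sub_le _ _ _
    _ ≤ ε / (2 * (c + 1)) * (|d| ^ α * φ) + |L| * |φ - c| * |d| ^ α := by
        rw [← hφ]; exact add_le_add hs_one hcorr
    _ = (ε / (2 * (c + 1)) * φ + |L| * |φ - c|) * |d| ^ α := by ring
    _ ≤ ε * |d| ^ α := by gcongr; linarith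

theorem rho_image {T : Set ℝ} (hT : IsClosed T) {f : ℝ → ℝ} (hf : StrictMonoOn f T)
    (hT' : IsClosed (f '' T)) {u : ℝ} (hu : u ∈ T) : rho (f '' T) (f u) = f (rho T u) := by
  have hr := rho_mem hT hu
  by_cases hne : ({s ∈ T | s < u}).Nonempty
  · obtain ⟨x, hx, hxe⟩ := rho_mem hT' (mem_image_of_mem f hu)
    apply le_antisymm
    · have hne' : ({s ∈ f '' T | s < f u}).Nonempty := by
        obtain ⟨s, hs, hsu⟩ := hne
        exact ⟨f s, mem_image_of_mem f hs, hf hs hu hsu⟩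
      rw [rho, if_pos hne']
      refine csSup_le hne' ?_
      rintro _ ⟨⟨s, hs, rfl⟩, hsu⟩
      exact hf.monotoneOn hs hr (le_rho hs ((hf.lt_iff_lt hs hu).1 hsu))
    · rw [← hxe]
      refine hf.monotoneOn hr hx ?_
      rw [rho, if_pos hne]
      refine csSup_le hne fun s hs => (hf.le_iff_le hs.1 hx).1 ?_
      rw [hxe]
      exact le_rho (mem_image_of_mem f hs.1) (hf hs.1 hu hs.2)
  · have hne' : ¬ ({s ∈ f '' T | s < f u}).Nonempty := by
      rintro ⟨_, ⟨s, hs, rfl⟩, hsu⟩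
      exact hne ⟨s, hs, (hf.lt_iff_lt hs hu).1 hsu⟩
    rw [rho, rho, if_neg hne, if_neg hne']

theorem mem_Tk_of_image {T : Set ℝ} (hT : IsClosed T) {f : ℝ → ℝ} (hf : StrictMonoOn f T)
    {u : ℝ} (hu : u ∈ T) (h : f u ∈ Tk (f '' T)) : u ∈ Tk T := by
  refine ⟨hu, fun ⟨hmin, hσ⟩ => h.2 ⟨hf.monotoneOn.map_isLeast hmin, ?_⟩⟩
  have hne : ({s ∈ T | u < s}).Nonempty := by
    by_contra hne
    rw [sigmaTS, if_neg hne] at hσ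
    exact hσ.false
  rw [sigmaTS, if_pos hne] at hσ
  have hbdd : BddBelow {s ∈ T | u < s} := ⟨u, fun x hx => hx.2.le⟩
  have hmem : sInf {s ∈ T | u < s} ∈ T :=
    closure_minimal (fun x hx => hx.1) hT (csInf_mem_closure hne hbdd)
  have hne' : ({s ∈ f '' T | f u < s}).Nonempty := by
    obtain ⟨s, hs, hus⟩ := hne
    exact ⟨f s, mem_image_of_mem f hs, hf hu hs hus⟩
  rw [sigmaTS, if_pos hne']
  refine (hf hu hmem hσ).trans_le (le_csInf hne' ?_)
  rintro _ ⟨⟨s, hs, rfl⟩, hus⟩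
  exact hf.monotoneOn hmem hs (csInf_le hbdd ⟨hs, (hf.lt_iff_lt hu hs).1 hus⟩)

/-- The inverse of a strictly increasing function on a closed set is continuous. -/
theorem StrictMonoOn.exists_image_close {T : Set ℝ} (hT : IsClosed T) {f : ℝ → ℝ}
    (hf : StrictMonoOn f T) {u : ℝ} (hu : u ∈ T) {δ : ℝ} (hδ : 0 < δ) :
    ∃ η > 0, ∀ x ∈ T, f x ∈ Ioo (f u - η) (f u + η) → x ∈ Ioo (u - δ) (u + δ) := by
  have hleft : ∃ η > 0, ∀ x ∈ T, f u - η < f x → u - δ < x := by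
    by_cases hne : (T ∩ Iic (u - δ)).Nonempty
    · have hbdd : BddAbove (T ∩ Iic (u - δ)) := ⟨u - δ, fun x hx => hx.2⟩
      have hm := (hT.inter isClosed_Iic).csSup_mem hne hbdd
      have hlt := hf hm.1 hu (by linarith [mem_Iic.1 hm.2])
      refine ⟨f u - f (sSup (T ∩ Iic (u - δ))), sub_pos.2 hlt, fun x hx h => ?_⟩
      by_contra! hxu
      have := hf.monotoneOn hx hm.1 (le_csSup hbdd ⟨hx, hxu⟩)
      linarith
    · refine ⟨1, one_pos, fun x hx _ => ?_⟩
      by_contra! hxu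
      exact hne ⟨x, hx, hxu⟩
  have hright : ∃ η > 0, ∀ x ∈ T, f x < f u + η → x < u + δ := by
    by_cases hne : (T ∩ Ici (u + δ)).Nonempty
    · have hbdd : BddBelow (T ∩ Ici (u + δ)) := ⟨u + δ, fun x hx => hx.2⟩
      have hm := (hT.inter isClosed_Ici).csInf_mem hne hbdd
      have hlt := hf hu hm.1 (by linarith [mem_Ici.1 hm.2])
      refine ⟨f (sInf (T ∩ Ici (u + δ))) - f u, sub_pos.2 hlt, fun x hx h => ?_⟩
      by_contra! hxu
      have := hf.monotoneOn hm.1 hx (csInf_le hbdd ⟨hx, hxu⟩)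
      linarith
    · refine ⟨1, one_pos, fun x hx _ => ?_⟩
      by_contra! hxu
      exact hne ⟨x, hx, hxu⟩
  obtain ⟨η₁, hη₁, h₁⟩ := hleft
  obtain ⟨η₂, hη₂, h₂⟩ := hright
  refine ⟨min η₁ η₂, lt_min hη₁ hη₂, fun x hx h => ⟨h₁ x hx ?_, h₂ x hx ?_⟩⟩
  · linarith [h.1, min_le_left η₁ η₂]
  · linarith [h.2, min_le_right η₁ η₂]

/-- The order `1` nabla derivative of an inverse function. -/
theorem nablaDiffAt_one_inverse {T : Set ℝ} (hT : IsClosed T) {f g : ℝ → ℝ}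
    (hf : StrictMonoOn f T) (hT' : IsClosed (f '' T)) (hgf : ∀ s ∈ T, g (f s) = s)
    {u L : ℝ} (hu : u ∈ T) (hL : L ≠ 0) (h : nablaDiffAt T 1 f u L) :
    nablaDiffAt (f '' T) 1 g (f u) (1 / L) := by
  rw [nablaDiffAt_one_iff] at h ⊢
  intro ε hε
  have hL' : 0 < |L| := abs_pos.2 hL
  obtain ⟨δ, hδ, hδf⟩ := h (min (|L| / 2) (ε * |L| ^ 2 / 2)) (by positivity)
  obtain ⟨η, hη, hηf⟩ := hf.exists_image_close hT hu hδ
  refine ⟨η, hη, ?_⟩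
  rintro _ ⟨hs, x, hx, rfl⟩
  have hfx := hδf x ⟨hηf x hx hs, hx⟩
  rw [rho_image hT hf hT' hu, hgf _ (rho_mem hT hu), hgf x hx]
  set r := rho T u
  set d := r - x
  set e := f r - f x
  have hb₁ : |e - L * d| ≤ |L| / 2 * |d| := hfx.trans (by gcongr; exact min_le_left _ _)
  have hb₂ : |e - L * d| ≤ ε * |L| ^ 2 / 2 * |d| :=
    hfx.trans (by gcongr; exact min_le_right _ _)
  have hlow : |L| / 2 * |d| ≤ |e| := by
    have htri : |L * d| ≤ |e| + |e - L * d| := by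
      have := abs_sub_abs_le_abs_sub (L * d) e
      rw [abs_sub_comm (L * d) e] at this
      linarith
    rw [abs_mul] at htri
    linarith
  have heq : d - 1 / L * e = -(e - L * d) / L := by field_simp; ring
  rw [heq, abs_div, abs_neg, div_le_iff₀ hL']
  calc |e - L * d| ≤ ε * |L| ^ 2 / 2 * |d| := hb₂
    _ = ε * |L| * (|L| / 2 * |d|) := by ring
    _ ≤ ε * |L| * |e| := by gcongr
    _ = ε * |e| * |L| := by ring

/-- Nabla fractional derivative of an inverse function. -/
theorem stmt16 (T : Set ℝ) (hTne : T.Nonempty) (hTcl : IsClosed T)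
    (α : ℝ) (hα : α ∈ Set.Ioc (0 : ℝ) 1)
    (f f' : ℝ → ℝ) (hf : StrictMonoOn f T) (hT' : IsClosed (f '' T))
    (hfdiff : ∀ u ∈ Tk T, nablaDiffAt T 1 f u (f' u))
    (hf'cont : ∀ u ∈ Tk T, contAt T f' u)
    (g : ℝ → ℝ) (hgf : ∀ s ∈ T, g (f s) = s) (hfg : ∀ u ∈ f '' T, f (g u) = u) :
    ∀ t ∈ Tk (f '' T), f' (g t) ≠ 0 →
      nablaDiffAt (f '' T) α g t
        (if α = 1 then 1 / f' (g t)
         else (nu (f '' T) t) ^ (1 - α) / f' (g t)) := by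
  rintro _ ⟨⟨u, hu, rfl⟩, hmin⟩ hne
  rw [hgf u hu] at hne ⊢
  have huk := mem_Tk_of_image hTcl hf hu ⟨mem_image_of_mem f hu, hmin⟩
  have hder := nablaDiffAt_of_one hα
    (nablaDiffAt_one_inverse hTcl hf hT' hgf hu hne (hfdiff u huk))
  split_ifs with h
  · simpa [h] using hder
  · rwa [mul_one_div] at hder
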